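/- arXiv:2501.12135 — 4 statements merged into one kernel-verified Lean document; each statement's English description precedes it below -/
import Mathlib

section
/- Given the same rate profile ∅ = I₀ ⊂ I₁ ⊆ ⋯ ⊆ I_r ⊆ I_{r+1} = {1,…,N} and any N×N upper-triangular matrix T with entries in {0,1} and unit diagonal, let Ḡ and Ḡ_pac = D·T·G_N be the generator matrices of the polar lattice and the PAC lattice, respectively. Then the minimum squared Euclidean distance of the PAC lattice is at least that of the polar lattice: d²_min(Λ(Ḡ_pac)) ≥ d²_min(Λ(Ḡ)), where d²_min(L) denotes the infimum of ‖x‖² over nonzero points x of the lattice L. -/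
open Matrix

/-!
The polarization matrix `G_N = [[1,0],[1,1]]^{⊗n}` (N = 2^n), viewed as a real
N×N matrix.  Its (i,j)-entry is the product over all bit positions `t` of
`[[1,0],[1,1]]_{i_t, j_t}`, which is `1` iff every binary digit of `j` is
dominated by the corresponding binary digit of `i`, i.e. iff `j &&& i = j`.
-/
def polarMatrix (n : ℕ) : Matrix (Fin (2 ^ n)) (Fin (2 ^ n)) ℝ :=
  fun i j => if j.val &&& i.val = j.val then 1 else 0

/-- The lattice generated by the rows of `B`: all integer combinations
`λ · B` of the rows of `B`. -/
def latticeOf {N : ℕ} (B : Matrix (Fin N) (Fin N) ℝ) : Set (Fin N → ℝ) :=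
  {x | ∃ lam : Fin N → ℤ, x = (fun i => (lam i : ℝ)) ᵥ* B}

/-- The minimum squared Euclidean distance of a lattice `L ⊆ ℝ^N`: the
infimum of `‖x‖²` over nonzero points `x ∈ L`. -/
noncomputable def dminSq {N : ℕ} (L : Set (Fin N → ℝ)) : ℝ :=
  sInf {d : ℝ | ∃ x ∈ L, x ≠ 0 ∧ d = ∑ j, x j ^ 2}

/-- The indicator of digitwise domination `j ≤ k`, i.e. the `(k, j)`-entry of the infinite
polarization matrix. -/
def dominated (R : Type*) [Zero R] [One R] (k j : ℕ) : R :=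
  if j &&& k = j then 1 else 0

lemma dominated_add_pow_right (R : Type*) [Zero R] [One R] {n j k : ℕ} (hj : j < 2 ^ n)
    (hk : k < 2 ^ n) : dominated R (2 ^ n + k) j = dominated R k j := by
  have h : j &&& (2 ^ n + k) = j &&& k := by
    have hlt : j &&& (2 ^ n + k) < 2 ^ n := Nat.and_le_left.trans_lt hj
    rw [← Nat.mod_eq_of_lt hlt, Nat.and_mod_two_pow, Nat.add_mod_left, ← Nat.and_mod_two_pow,
      Nat.mod_eq_of_lt (Nat.and_lt_two_pow _ hk)]
  simp [dominated, h]

lemma dominated_add_pow_left (R : Type*) [Zero R] [One R] {n j k : ℕ}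
    (hk : k < 2 ^ n) : dominated R k (2 ^ n + j) = 0 := by
  have h : (2 ^ n + j) &&& k < 2 ^ n := Nat.and_lt_two_pow _ hk
  rw [dominated, if_neg (by omega)]

lemma dominated_add_pow_add_pow (R : Type*) [Zero R] [One R] {n j k : ℕ} (hj : j < 2 ^ n)
    (hk : k < 2 ^ n) : dominated R (2 ^ n + k) (2 ^ n + j) = dominated R k j := by
  have h : (2 ^ n + j) &&& (2 ^ n + k) = 2 ^ n + (j &&& k) := by
    have hor : ∀ m < 2 ^ n, 2 ^ n + m = 2 ^ n ||| m := fun m hm => by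
      simpa using Nat.two_pow_add_eq_or_of_lt hm 1
    rw [hor j hj, hor k hk, hor _ (Nat.and_lt_two_pow _ hk), Nat.or_and_distrib_left]
  simp [dominated, h]

/-- The binary polar codeword of `c` at position `j`, in block length `2 ^ n`. -/
def polarCodeword (n : ℕ) (c : ℕ → ZMod 2) (j : ℕ) : ZMod 2 :=
  ∑ k ∈ Finset.range (2 ^ n), c k * dominated (ZMod 2) k j

lemma polarCodeword_succ_low {n j : ℕ} (c : ℕ → ZMod 2) (hj : j < 2 ^ n) :
    polarCodeword (n + 1) c j =
      polarCodeword n c j + polarCodeword n (fun k => c (2 ^ n + k)) j := by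
  unfold polarCodeword
  rw [pow_succ, mul_two, Finset.sum_range_add]
  congr 1
  refine Finset.sum_congr rfl fun k hk => ?_
  rw [dominated_add_pow_right _ hj (Finset.mem_range.1 hk)]

lemma polarCodeword_succ_high {n j : ℕ} (c : ℕ → ZMod 2) (hj : j < 2 ^ n) :
    polarCodeword (n + 1) c (2 ^ n + j) = polarCodeword n (fun k => c (2 ^ n + k)) j := by
  unfold polarCodeword
  rw [pow_succ, mul_two, Finset.sum_range_add, Finset.sum_eq_zero, zero_add]
  · refine Finset.sum_congr rfl fun k hk => ?_
    rw [dominated_add_pow_add_pow _ hj (Finset.mem_range.1 hk)]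
  · intro k hk
    rw [dominated_add_pow_left _ (Finset.mem_range.1 hk), mul_zero]

/-- A binary combination of rows of the polarization matrix weighs at least as much as its
first row. -/
lemma weight_row_le_weight_polarCodeword (n : ℕ) (c : ℕ → ZMod 2) (i : ℕ) (hi : i < 2 ^ n)
    (hci : c i ≠ 0) (hc : ∀ k < i, c k = 0) :
    ∑ j ∈ Finset.range (2 ^ n), dominated ℕ i j ≤
      ∑ j ∈ Finset.range (2 ^ n), if polarCodeword n c j ≠ 0 then 1 else 0 := by
  induction n generalizing c i with
  | zero =>
    obtain rfl : i = 0 := by simpa using hi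
    simp [polarCodeword, dominated, hci]
  | succ n ih =>
    have hweight : (∑ j ∈ Finset.range (2 ^ (n + 1)),
        if polarCodeword (n + 1) c j ≠ 0 then 1 else 0) =
        ∑ j ∈ Finset.range (2 ^ n),
          ((if polarCodeword n c j + polarCodeword n (fun k => c (2 ^ n + k)) j ≠ 0
              then 1 else 0) +
            if polarCodeword n (fun k => c (2 ^ n + k)) j ≠ 0 then 1 else 0) := by
      rw [pow_succ, mul_two, Finset.sum_range_add, ← Finset.sum_add_distrib]
      refine Finset.sum_congr rfl fun j hj => ?_
      rw [polarCodeword_succ_low c (Finset.mem_range.1 hj),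
        polarCodeword_succ_high c (Finset.mem_range.1 hj)]
    rw [hweight, pow_succ, mul_two, Finset.sum_range_add]
    rcases lt_or_ge i (2 ^ n) with h | h
    · rw [Finset.sum_eq_zero (f := fun j => dominated ℕ i (2 ^ n + j))
        fun j _ => dominated_add_pow_left ℕ h, add_zero]
      refine (ih c i h hci hc).trans (Finset.sum_le_sum fun j _ => ?_)
      have key : ∀ a b : ZMod 2, (if a ≠ 0 then 1 else 0) ≤
        (if a + b ≠ 0 then 1 else 0) + if b ≠ 0 then 1 else 0 := by decide
      exact key _ _
    · obtain ⟨i, rfl⟩ := Nat.exists_eq_add_of_le h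
      have hi' : i < 2 ^ n := by rw [pow_succ] at hi; omega
      have hlow : ∀ j, polarCodeword n c j = 0 := fun j =>
        Finset.sum_eq_zero fun k hk => by
          rw [hc k (by have := Finset.mem_range.1 hk; omega), zero_mul]
      have hrec := ih (fun k => c (2 ^ n + k)) i hi' hci fun k hk => hc _ (by omega)
      simp only [hlow, zero_add, Finset.sum_add_distrib]
      refine add_le_add ?_ ?_
      · rwa [Finset.sum_congr rfl fun j hj =>
          dominated_add_pow_right ℕ (Finset.mem_range.1 hj) hi']
      · rwa [Finset.sum_congr rfl fun j hj =>
          dominated_add_pow_add_pow ℕ (Finset.mem_range.1 hj) hi']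

lemma weight_row_le_weight_combination {n : ℕ} (c : Fin (2 ^ n) → ZMod 2) (i : Fin (2 ^ n))
    (hci : c i ≠ 0) (hc : ∀ k < i, c k = 0) :
    ∑ j : Fin (2 ^ n), dominated ℕ i j ≤
      ∑ j : Fin (2 ^ n), if ∑ k, c k * dominated (ZMod 2) k j ≠ 0 then 1 else 0 := by
  have h := weight_row_le_weight_polarCodeword n
    (fun k => if hk : k < 2 ^ n then c ⟨k, hk⟩ else 0) i i.2 (by simpa using hci)
    (fun k hk => by
      rw [dif_pos (hk.trans i.2)]
      exact hc _ hk)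
  simpa [polarCodeword, Finset.sum_range] using h

/-- A nonzero integer vector is a power of two times a vector having an odd entry. -/
lemma exists_eq_two_pow_mul_odd {ι : Type*} (a : ι → ℤ) (ha : a ≠ 0) :
    ∃ (s : ℕ) (b : ι → ℤ), (∀ k, a k = 2 ^ s * b k) ∧ ∃ k, ¬ (2 : ℤ) ∣ b k := by
  classical
  obtain ⟨k₀, hk₀⟩ := Function.ne_iff.1 ha
  have hex : ∃ m, ¬ ∀ k, (2 : ℤ) ^ m ∣ a k := by
    obtain ⟨m, hm⟩ := FiniteMultiplicity.def.1
      ((Int.finiteMultiplicity_iff (a := 2) (b := a k₀)).2 ⟨by decide, hk₀⟩)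
    exact ⟨m + 1, fun h => hm (h k₀)⟩
  obtain ⟨s, hs⟩ : ∃ s, Nat.find hex = s + 1 := by
    refine Nat.exists_eq_succ_of_ne_zero fun h => ?_
    exact Nat.find_spec hex fun k => by rw [h, pow_zero]; exact one_dvd _
  have hdvd : ∀ k, (2 : ℤ) ^ s ∣ a k := not_not.1 (Nat.find_min hex (m := s) (by omega))
  choose b hb using hdvd
  refine ⟨s, b, hb, ?_⟩
  by_contra! hodd
  refine Nat.find_spec hex fun k => ?_
  rw [hs, hb k, pow_succ]
  exact mul_dvd_mul_left _ (hodd k)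

/-- Every nonzero integer combination of the rows of a scaled pretransformed polarization matrix
is at least as long as some scaled row of the polarization matrix. -/
lemma exists_scaled_row_sq_le {n : ℕ} (lev : Fin (2 ^ n) → ℕ)
    (t : Matrix (Fin (2 ^ n)) (Fin (2 ^ n)) ℤ)
    (htupper : ∀ i j, j < i → t i j = 0) (htdiag : ∀ i, t i i = 1)
    (lam : Fin (2 ^ n) → ℤ) (hlam : lam ≠ 0) :
    ∃ i, ∑ j : Fin (2 ^ n), ((2 : ℤ) ^ lev i * dominated ℤ i j) ^ 2 ≤
      ∑ j : Fin (2 ^ n),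
        (∑ l, (∑ k, lam k * 2 ^ lev k * t k l) * dominated ℤ l j) ^ 2 := by
  classical
  obtain ⟨s, b, hb, hodd⟩ := exists_eq_two_pow_mul_odd (fun k => lam k * 2 ^ lev k) (by
    obtain ⟨k, hk⟩ := Function.ne_iff.1 hlam
    exact Function.ne_iff.2 ⟨k, mul_ne_zero hk (by positivity)⟩)
  obtain ⟨i, hi, hmin⟩ := WellFounded.has_min (wellFounded_lt (α := Fin (2 ^ n)))
    {k | ¬ (2 : ℤ) ∣ b k} hodd
  have hbi : ∀ k < i, (b k : ZMod 2) = 0 := fun k hk =>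
    (ZMod.intCast_zmod_eq_zero_iff_dvd _ 2).2 (by
      by_contra h
      exact hmin k (by simpa using h) hk)
  have hcast : ∀ z : ℤ, ¬ (2 : ℤ) ∣ z → (z : ZMod 2) ≠ 0 := fun z hz h =>
    hz (by simpa using (ZMod.intCast_zmod_eq_zero_iff_dvd _ 2).1 h)
  have hlev : lev i ≤ s := by
    have hdvd : (2 : ℤ) ^ lev i ∣ 2 ^ s * b i := hb i ▸ dvd_mul_left _ _
    have hcop : IsCoprime ((2 : ℤ) ^ lev i) (b i) :=
      ((Int.prime_two.coprime_iff_not_dvd).2 hi).pow_left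
    exact (pow_dvd_pow_iff (by decide) (by decide)).1 (hcop.dvd_of_dvd_mul_right hdvd)
  set y : Fin (2 ^ n) → ℤ := fun j => ∑ l, (∑ k, b k * t k l) * dominated ℤ l j with hy
  set c : Fin (2 ^ n) → ZMod 2 := fun l => ∑ k, (b k : ZMod 2) * (t k l : ZMod 2) with hc
  have hyc : ∀ j, (y j : ZMod 2) = ∑ l, c l * dominated (ZMod 2) l j := by
    intro j
    simp [hy, hc, dominated]
  have hcl : ∀ l < i, c l = 0 := fun l hl => Finset.sum_eq_zero fun k _ => by
    rcases lt_or_ge k i with h | h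
    · rw [hbi k h, zero_mul]
    · rw [htupper k l (hl.trans_le h), Int.cast_zero, mul_zero]
  have hci : c i ≠ 0 := by
    have : c i = b i := by
      rw [hc]
      dsimp only
      rw [Finset.sum_eq_single i, htdiag, Int.cast_one, mul_one]
      · intro k _ hk
        rcases lt_or_gt_of_ne hk with h | h
        · rw [hbi k h, zero_mul]
        · rw [htupper k i h, Int.cast_zero, mul_zero]
      · simp
    rw [this]
    exact hcast _ hi
  have hweight := weight_row_le_weight_combination c i hci hcl
  have hx : ∀ j : Fin (2 ^ n), (∑ l, (∑ k, lam k * 2 ^ lev k * t k l) * dominated ℤ l j) =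
      2 ^ s * y j := by
    intro j
    simp only [hy, hb, Finset.mul_sum, mul_assoc, Finset.sum_mul]
  refine ⟨i, ?_⟩
  simp only [hx, mul_pow, ← Finset.mul_sum]
  refine mul_le_mul ?_ ?_ (by positivity) (by positivity)
  · exact pow_le_pow_left₀ (by positivity) (pow_le_pow_right₀ (by decide) hlev) 2
  · calc ∑ j : Fin (2 ^ n), dominated ℤ i j ^ 2
        = ((∑ j : Fin (2 ^ n), dominated ℕ i j : ℕ) : ℤ) := by
          push_cast
          exact Finset.sum_congr rfl fun j _ => by simp [dominated]
      _ ≤ ((∑ j : Fin (2 ^ n), if ∑ k, c k * dominated (ZMod 2) k j ≠ 0 then 1 else 0 : ℕ) : ℤ) :=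
          Int.ofNat_le.2 hweight
      _ ≤ ∑ j, y j ^ 2 := by
          push_cast
          refine Finset.sum_le_sum fun j _ => ?_
          rw [← hyc j]
          split_ifs with h
          · have : y j ≠ 0 := fun h0 => h (by simp [h0])
            have := sq_pos_of_ne_zero this
            omega
          · positivity

/-- Lemma 3 of the paper.
Given the same rate profile `∅ = I₀ ⊂ I₁ ⊆ ⋯ ⊆ I_r ⊆ I_{r+1} = {1,…,N}` and
any upper-triangular matrix `T` with entries in `{0,1}` and unit diagonal, let
`Ḡ = D·G_N` and `Ḡ_pac = D·T·G_N` be the generator matrices of the polar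
lattice and the PAC lattice.  Then
`d²_min(Λ(Ḡ_pac)) ≥ d²_min(Λ(Ḡ))`. -/
theorem pac_dminSq_ge_polar_dminSq
    (n r : ℕ) (hn : 1 ≤ n) (hr : r < 2 ^ n)
    (I : ℕ → Finset (Fin (2 ^ n)))
    (hI0 : I 0 = ∅)
    (hItop : I (r + 1) = Finset.univ)
    (hchain : ∀ ℓ ≤ r, I ℓ ⊆ I (ℓ + 1))
    (hstrict : I 0 ⊂ I 1)
    (lev : Fin (2 ^ n) → ℕ)
    (hlev : ∀ k, lev k ≤ r ∧ k ∈ I (lev k + 1) ∧ k ∉ I (lev k))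
    (D : Matrix (Fin (2 ^ n)) (Fin (2 ^ n)) ℝ)
    (hD : D = Matrix.diagonal fun k => (2 : ℝ) ^ lev k)
    (T : Matrix (Fin (2 ^ n)) (Fin (2 ^ n)) ℝ)
    (hT01 : ∀ i j, T i j = 0 ∨ T i j = 1)
    (hTupper : ∀ i j : Fin (2 ^ n), j < i → T i j = 0)
    (hTdiag : ∀ i, T i i = 1) :
    dminSq (latticeOf (D * T * polarMatrix n)) ≥
      dminSq (latticeOf (D * polarMatrix n)) := by
  obtain ⟨t, rfl⟩ : ∃ t : Matrix (Fin (2 ^ n)) (Fin (2 ^ n)) ℤ, T = t.map (fun z => (z : ℝ)) := by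
    have h : ∀ i j, ∃ z : ℤ, T i j = z := fun i j =>
      (hT01 i j).elim (fun h => ⟨0, by simp [h]⟩) (fun h => ⟨1, by simp [h]⟩)
    choose t ht using h
    exact ⟨t, by ext i j; exact ht i j⟩
  simp only [Matrix.map_apply, Int.cast_eq_zero, Int.cast_eq_one] at hTupper hTdiag
  have hpac : ∀ (lam : Fin (2 ^ n) → ℤ) (j : Fin (2 ^ n)),
      ((fun i => (lam i : ℝ)) ᵥ* (D * t.map (fun z => (z : ℝ)) * polarMatrix n)) j =
        ((∑ l, (∑ k, lam k * 2 ^ lev k * t k l) * dominated ℤ l j : ℤ) : ℝ) := by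
    intro lam j
    rw [hD, ← Matrix.vecMul_vecMul, ← Matrix.vecMul_vecMul]
    simp [Matrix.vecMul, dotProduct, polarMatrix, dominated, Matrix.diagonal_apply]
  have hrow : ∀ i j : Fin (2 ^ n), (D * polarMatrix n) i j =
      (((2 : ℤ) ^ lev i * dominated ℤ i j : ℤ) : ℝ) := by
    intro i j
    rw [hD, Matrix.diagonal_mul]
    simp [polarMatrix, dominated]
  have hrow_mem : ∀ i, (D * polarMatrix n) i ∈ latticeOf (D * polarMatrix n) := by
    intro i
    refine ⟨Pi.single i 1, ?_⟩
    have h : (fun k => ((Pi.single i (1 : ℤ) : Fin (2 ^ n) → ℤ) k : ℝ)) = Pi.single i 1 := by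
      ext k
      by_cases hk : k = i <;> simp [hk]
    rw [h, Matrix.single_one_vecMul]
    rfl
  have hrow_ne : ∀ i, (D * polarMatrix n) i ≠ 0 := by
    intro i h
    have := congrFun h i
    rw [hrow] at this
    simp [dominated] at this
  have hle : ∀ lam : Fin (2 ^ n) → ℤ, lam ≠ 0 → ∃ i, ∑ j, (D * polarMatrix n) i j ^ 2 ≤
      ∑ j, ((fun i => (lam i : ℝ)) ᵥ* (D * t.map (fun z => (z : ℝ)) * polarMatrix n)) j ^ 2 := by
    intro lam hlam
    obtain ⟨i, hi⟩ := exists_scaled_row_sq_le lev t hTupper hTdiag lam hlam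
    refine ⟨i, ?_⟩
    simp only [hpac, hrow]
    exact_mod_cast hi
  refine le_csInf ?_ ?_
  · obtain ⟨i, hi⟩ := hle 1 one_ne_zero
    refine ⟨_, _, ⟨1, rfl⟩, fun h => ?_, rfl⟩
    rw [h] at hi
    obtain ⟨j, hj⟩ := Function.ne_iff.1 (hrow_ne i)
    have hpos : 0 < ∑ j, (D * polarMatrix n) i j ^ 2 :=
      Finset.sum_pos' (fun _ _ => sq_nonneg _) ⟨j, Finset.mem_univ j, sq_pos_of_ne_zero hj⟩
    simp only [Pi.zero_apply, ne_eq, OfNat.ofNat_ne_zero, not_false_eq_true, zero_pow,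
      Finset.sum_const_zero] at hi
    linarith
  · rintro d ⟨x, ⟨lam, rfl⟩, hx, rfl⟩
    obtain ⟨i, hi⟩ := hle lam (by
      rintro rfl
      refine hx ?_
      ext j
      simp [Matrix.vecMul, dotProduct])
    refine le_trans (csInf_le ⟨0, ?_⟩ ⟨_, hrow_mem i, hrow_ne i, rfl⟩) hi
    rintro _ ⟨x, -, -, rfl⟩
    exact Finset.sum_nonneg fun _ _ => sq_nonneg _
end

section
/- For a polar lattice Λ(Ḡ) with rate profile ∅ = I₀ ⊂ I₁ ⊆ ⋯ ⊆ I_r ⊆ I_{r+1} = {1,…,N}, let C_ℓ (for 1 ≤ ℓ ≤ r) be the binary linear code of length N generated over 𝔽₂ by the rows of G_N (reduced mod 2) with indices in I_ℓ, and let d_H(C_ℓ) be the minimum Hamming weight of a nonzero codeword of C_ℓ. Then the minimum squared Euclidean distance of the polar lattice satisfies d²_min(Λ(Ḡ)) = min( min_{1 ≤ ℓ ≤ r} 4^{ℓ−1}·d_H(C_ℓ), 4^r ). -/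
open Matrix

/-- The polarization matrix `G_N` reduced mod 2, viewed over `𝔽₂`. -/
def polarMatrix2 (n : ℕ) : Matrix (Fin (2 ^ n)) (Fin (2 ^ n)) (ZMod 2) :=
  fun i j => if j.val &&& i.val = j.val then 1 else 0

/-- The binary linear code of length `N = 2^n` generated over `𝔽₂` by the rows
of `G_N` (mod 2) with indices in the set `s`. -/
def polarCode (n : ℕ) (s : Finset (Fin (2 ^ n))) : Set (Fin (2 ^ n) → ZMod 2) :=
  {c | ∃ u : Fin (2 ^ n) → ZMod 2, (∀ i, i ∉ s → u i = 0) ∧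
    c = u ᵥ* polarMatrix2 n}

/-- The minimum Hamming weight/distance of a nonzero codeword of a code `C`. -/
noncomputable def dH {N : ℕ} (C : Set (Fin N → ZMod 2)) : ℕ :=
  sInf {w : ℕ | ∃ c ∈ C, c ≠ 0 ∧
    w = (Finset.univ.filter fun j => c j ≠ 0).card}

section Domination

theorem land_two_pow_add_right {n i j : ℕ} (hi : i < 2 ^ n) (hj : j < 2 ^ n) :
    j &&& (2 ^ n + i) = j ↔ j &&& i = j := by
  have h : j &&& (2 ^ n + i) = j &&& i := by
    rw [← Nat.div_add_mod (j &&& (2 ^ n + i)) (2 ^ n), Nat.and_div_two_pow,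
      Nat.and_mod_two_pow, Nat.div_eq_of_lt hj, Nat.add_mod_left, Nat.mod_eq_of_lt hi,
      Nat.mod_eq_of_lt hj]
    simp
  rw [h]

theorem land_two_pow_add_left {n i j : ℕ} (hi : i < 2 ^ n) :
    ¬ (2 ^ n + j) &&& i = 2 ^ n + j := by
  intro h
  have h1 : (2 ^ n + j) &&& i ≤ i := Nat.and_le_right
  omega

theorem land_two_pow_add_two_pow_add {n i j : ℕ} (hi : i < 2 ^ n) (hj : j < 2 ^ n) :
    (2 ^ n + j) &&& (2 ^ n + i) = 2 ^ n + j ↔ j &&& i = j := by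
  have h : (2 ^ n + j) &&& (2 ^ n + i) = 2 ^ n + (j &&& i) := by
    have hp : 0 < 2 ^ n := by positivity
    rw [← Nat.div_add_mod ((2 ^ n + j) &&& (2 ^ n + i)) (2 ^ n), Nat.and_div_two_pow,
      Nat.and_mod_two_pow, Nat.add_div_left _ hp, Nat.add_div_left _ hp, Nat.div_eq_of_lt hi,
      Nat.div_eq_of_lt hj, Nat.add_mod_left, Nat.add_mod_left, Nat.mod_eq_of_lt hi,
      Nat.mod_eq_of_lt hj]
    simp
  rw [h]
  omega

end Domination

open Finset in
/-- A nonzero combination of rows of the polarization matrix over `𝔽₂` is at least as heavy as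
one of the rows it involves. -/
theorem exists_row_weight_le_nat (n : ℕ) (u : ℕ → ZMod 2) (hu : ∃ i < 2 ^ n, u i ≠ 0) :
    ∃ i < 2 ^ n, u i ≠ 0 ∧
      ∑ j ∈ range (2 ^ n), (if j &&& i = j then 1 else 0) ≤
        ∑ j ∈ range (2 ^ n),
          if ∑ k ∈ range (2 ^ n), (if j &&& k = j then u k else 0) = 0 then 0 else 1 := by
  induction n generalizing u with
  | zero =>
    obtain ⟨i, hi, hui⟩ := hu
    obtain rfl : i = 0 := by simpa using hi
    exact ⟨0, by simp, hui, by simp [hui]⟩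
  | succ n ih =>
    have hlow : ∀ j ∈ range (2 ^ n),
        ∑ k ∈ range (2 ^ n), (if j &&& (2 ^ n + k) = j then u (2 ^ n + k) else 0) =
          ∑ k ∈ range (2 ^ n), (if j &&& k = j then u (2 ^ n + k) else 0) := fun j hj =>
      sum_congr rfl fun k hk => if_congr
        (land_two_pow_add_right (mem_range.1 hk) (mem_range.1 hj)) rfl rfl
    have hzero : ∀ j, ∑ k ∈ range (2 ^ n),
        (if (2 ^ n + j) &&& k = 2 ^ n + j then u k else 0) = 0 := fun j =>
      sum_eq_zero fun k hk => if_neg (land_two_pow_add_left (mem_range.1 hk))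
    have hhigh : ∀ j ∈ range (2 ^ n),
        ∑ k ∈ range (2 ^ n),
            (if (2 ^ n + j) &&& (2 ^ n + k) = 2 ^ n + j then u (2 ^ n + k) else 0) =
          ∑ k ∈ range (2 ^ n), (if j &&& k = j then u (2 ^ n + k) else 0) := fun j hj =>
      sum_congr rfl fun k hk => if_congr
        (land_two_pow_add_two_pow_add (mem_range.1 hk) (mem_range.1 hj)) rfl rfl
    simp only [pow_succ, mul_two, sum_range_add, hzero, zero_add]
    rw [← sum_add_distrib]
    simp only [← sum_add_distrib]
    by_cases h : ∃ i < 2 ^ n, u i ≠ 0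
    · obtain ⟨i, hi, hui, hw⟩ := ih u h
      refine ⟨i, by omega, hui, le_trans (le_of_eq ?_) (hw.trans (sum_le_sum ?_))⟩
      · refine sum_congr rfl fun j _ => ?_
        rw [if_neg (land_two_pow_add_left hi), add_zero]
      · intro j hj
        rw [sum_add_distrib, hlow j hj, hhigh j hj]
        split_ifs <;> simp_all
    · push Not at h
      obtain ⟨i, hi, hui⟩ := hu
      have hex : ∃ k < 2 ^ n, u (2 ^ n + k) ≠ 0 := by
        have hin : 2 ^ n ≤ i := by
          by_contra hlt
          exact hui (h i (by omega))
        refine ⟨i - 2 ^ n, by rw [pow_succ] at hi; omega, ?_⟩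
        rwa [Nat.add_sub_cancel' hin]
      obtain ⟨k, hk, huk, hw⟩ := ih (fun k => u (2 ^ n + k)) hex
      refine ⟨2 ^ n + k, by omega, huk, ?_⟩
      rw [sum_add_distrib, sum_add_distrib]
      refine add_le_add (le_trans (le_of_eq ?_) (hw.trans (le_of_eq ?_)))
        (le_trans (le_of_eq ?_) (hw.trans (le_of_eq ?_)))
      · exact sum_congr rfl fun j hj => if_congr
          (land_two_pow_add_right hk (mem_range.1 hj)) rfl rfl
      · refine sum_congr rfl fun j hj => ?_
        have hA : ∑ l ∈ range (2 ^ n), (if j &&& l = j then u l else 0) = 0 :=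
          sum_eq_zero fun l hl => by simp [h l (mem_range.1 hl)]
        rw [sum_add_distrib, hA, zero_add, hlow j hj]
      · exact sum_congr rfl fun j hj => if_congr
          (land_two_pow_add_two_pow_add hk (mem_range.1 hj)) rfl rfl
      · refine sum_congr rfl fun j hj => ?_
        rw [hhigh j hj]

theorem vecMul_polarMatrix2_apply {n : ℕ} (u : Fin (2 ^ n) → ZMod 2) (j : Fin (2 ^ n)) :
    (u ᵥ* polarMatrix2 n) j = ∑ i, if j.val &&& i.val = j.val then u i else 0 := by
  simp [vecMul, dotProduct, polarMatrix2]

theorem exists_row_weight_le {n : ℕ} (u : Fin (2 ^ n) → ZMod 2) (hu : u ≠ 0) :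
    ∃ i, u i ≠ 0 ∧ (Finset.univ.filter fun j : Fin (2 ^ n) => j.val &&& i.val = j.val).card ≤
      (Finset.univ.filter fun j => (u ᵥ* polarMatrix2 n) j ≠ 0).card := by
  obtain ⟨i₀, hi₀⟩ := Function.ne_iff.1 hu
  let v : ℕ → ZMod 2 := fun k => if h : k < 2 ^ n then u ⟨k, h⟩ else 0
  have hv : ∀ i : Fin (2 ^ n), v i = u i := fun i => by simp [v]
  obtain ⟨i, hi, hvi, hw⟩ := exists_row_weight_le_nat n v
    ⟨i₀, i₀.2, by rw [hv]; exact hi₀⟩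
  refine ⟨⟨i, hi⟩, by rwa [← hv], ?_⟩
  simp only [← Fin.sum_univ_eq_sum_range
    (fun j => if j &&& i = j then (1 : ℕ) else 0)] at hw
  simp only [Finset.sum_range, hv] at hw
  simp only [Finset.card_filter, vecMul_polarMatrix2_apply, ne_eq, ite_not]
  exact hw

theorem row_weight_pos {n : ℕ} (i : Fin (2 ^ n)) :
    0 < (Finset.univ.filter fun j : Fin (2 ^ n) => j.val &&& i.val = j.val).card :=
  Finset.card_pos.2 ⟨i, by simp⟩

theorem eq_zero_of_vecMul_polarMatrix2_eq_zero {n : ℕ} {u : Fin (2 ^ n) → ZMod 2}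
    (h : u ᵥ* polarMatrix2 n = 0) : u = 0 := by
  by_contra hu
  obtain ⟨i, -, hw⟩ := exists_row_weight_le u hu
  have := row_weight_pos i
  simp only [h, Pi.zero_apply, ne_eq, not_true_eq_false, Finset.filter_false,
    Finset.card_empty] at hw
  omega

theorem dH_le {N : ℕ} {C : Set (Fin N → ZMod 2)} {c : Fin N → ZMod 2} (hc : c ∈ C)
    (h0 : c ≠ 0) : dH C ≤ (Finset.univ.filter fun j => c j ≠ 0).card :=
  Nat.sInf_le ⟨c, hc, h0, rfl⟩

/-- The minimum distance of a polar code is at least the weight of one of its generating rows. -/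
theorem exists_row_weight_le_dH {n : ℕ} {s : Finset (Fin (2 ^ n))} (hs : s.Nonempty) :
    ∃ i ∈ s, (Finset.univ.filter fun j : Fin (2 ^ n) => j.val &&& i.val = j.val).card ≤
      dH (polarCode n s) := by
  obtain ⟨k, hk⟩ := hs
  have hne : {w : ℕ | ∃ c ∈ polarCode n s, c ≠ 0 ∧
      w = (Finset.univ.filter fun j => c j ≠ 0).card}.Nonempty := by
    refine ⟨_, Pi.single k 1 ᵥ* polarMatrix2 n, ⟨Pi.single k 1, ?_, rfl⟩, ?_, rfl⟩
    · intro i hi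
      exact Pi.single_eq_of_ne (by rintro rfl; exact hi hk) _
    · intro h
      simpa using congrFun (eq_zero_of_vecMul_polarMatrix2_eq_zero h) k
  obtain ⟨c, ⟨u, hus, rfl⟩, hc0, hw⟩ := Nat.sInf_mem hne
  have hu : u ≠ 0 := by
    rintro rfl
    simp at hc0
  obtain ⟨i, hi, hle⟩ := exists_row_weight_le u hu
  refine ⟨i, by_contra fun h => hi (hus i h), ?_⟩
  rw [dH, hw]
  exact hle

theorem dminSq_le {N : ℕ} {L : Set (Fin N → ℝ)} {x : Fin N → ℝ} (hx : x ∈ L) (h0 : x ≠ 0) :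
    dminSq L ≤ ∑ j, x j ^ 2 := by
  refine csInf_le ⟨0, ?_⟩ ⟨x, hx, h0, rfl⟩
  rintro d ⟨y, -, -, rfl⟩
  exact Finset.sum_nonneg fun j _ => sq_nonneg _

/-- The integer matrix underlying `polarMatrix` and `polarMatrix2`. -/
def polarMatrixInt (n : ℕ) : Matrix (Fin (2 ^ n)) (Fin (2 ^ n)) ℤ :=
  fun i j => if j.val &&& i.val = j.val then 1 else 0

theorem intCast_vecMul_polarMatrixInt {n : ℕ} (μ : Fin (2 ^ n) → ℤ) (j : Fin (2 ^ n)) :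
    (((μ ᵥ* polarMatrixInt n) j : ℤ) : ZMod 2) =
      ((fun i => (μ i : ZMod 2)) ᵥ* polarMatrix2 n) j := by
  simp [vecMul, dotProduct, polarMatrixInt, polarMatrix2]

theorem card_odd_le_sum_sq {N : ℕ} (z : Fin N → ℤ) :
    (((Finset.univ.filter fun j => (z j : ZMod 2) ≠ 0).card : ℕ) : ℤ) ≤ ∑ j, z j ^ 2 := by
  rw [Finset.card_filter]
  push_cast
  refine Finset.sum_le_sum fun j _ => ?_
  split_ifs with h
  · have hz : z j ≠ 0 := fun h0 => h (by simp [h0])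
    have := sq_pos_of_ne_zero hz
    omega
  · positivity

theorem one_le_sum_sq {N : ℕ} {z : Fin N → ℤ} (hz : z ≠ 0) : 1 ≤ ∑ j, z j ^ 2 := by
  obtain ⟨j, hj⟩ := Function.ne_iff.1 hz
  have h1 : z j ^ 2 ≤ ∑ j, z j ^ 2 :=
    Finset.single_le_sum (f := fun j => z j ^ 2) (fun i _ => sq_nonneg _) (Finset.mem_univ j)
  have h2 : 0 < z j ^ 2 := sq_pos_of_ne_zero hj
  omega

/-- An integer combination of rows that is divisible by `2 ^ m`, with coefficients outside `s`
divisible by `2 ^ (m + 1)`, is either long or has all coefficients divisible by `2 ^ (m + 1)`. -/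
theorem dH_le_or_two_pow_succ_dvd {n m : ℕ} (s : Finset (Fin (2 ^ n))) (a : Fin (2 ^ n) → ℤ)
    (ha : ∀ i, (2 : ℤ) ^ m ∣ a i) (has : ∀ i, i ∉ s → (2 : ℤ) ^ (m + 1) ∣ a i) :
    (4 : ℤ) ^ m * dH (polarCode n s) ≤ ∑ j, (a ᵥ* polarMatrixInt n) j ^ 2 ∨
      ∀ i, (2 : ℤ) ^ (m + 1) ∣ a i := by
  choose μ hμ using ha
  have hiff : ∀ i, (2 : ℤ) ^ (m + 1) ∣ a i ↔ (μ i : ZMod 2) = 0 := fun i => by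
    rw [hμ, pow_succ, mul_dvd_mul_iff_left (by positivity), ZMod.intCast_zmod_eq_zero_iff_dvd]
    rfl
  have haμ : a = (2 : ℤ) ^ m • μ := funext fun i => by simp [hμ]
  by_cases hc : (fun i => (μ i : ZMod 2)) ᵥ* polarMatrix2 n = 0
  · right
    intro i
    rw [hiff]
    exact congrFun (eq_zero_of_vecMul_polarMatrix2_eq_zero hc) i
  · left
    have h1 := dH_le (C := polarCode n s)
      ⟨fun i => (μ i : ZMod 2), fun i hi => (hiff i).1 (has i hi), rfl⟩ hc
    have h2 := card_odd_le_sum_sq (μ ᵥ* polarMatrixInt n)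
    simp only [intCast_vecMul_polarMatrixInt] at h2
    have h3 : ∑ j, (a ᵥ* polarMatrixInt n) j ^ 2 =
        4 ^ m * ∑ j, (μ ᵥ* polarMatrixInt n) j ^ 2 := by
      rw [haμ, smul_vecMul, Finset.mul_sum]
      refine Finset.sum_congr rfl fun j _ => ?_
      rw [Pi.smul_apply, smul_eq_mul, mul_pow, ← pow_mul, mul_comm m 2, pow_mul]
      norm_num
    rw [h3]
    exact mul_le_mul_of_nonneg_left (le_trans (by exact_mod_cast h1) h2) (by positivity)

theorem exists_dH_le_or_two_pow_dvd {n r : ℕ} (I : ℕ → Finset (Fin (2 ^ n)))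
    (a : Fin (2 ^ n) → ℤ) (ha : ∀ m ≤ r, ∀ i, i ∉ I m → (2 : ℤ) ^ m ∣ a i) :
    ∀ m ≤ r, (∃ ℓ ∈ Finset.Icc 1 r,
      (4 : ℤ) ^ (ℓ - 1) * dH (polarCode n (I ℓ)) ≤ ∑ j, (a ᵥ* polarMatrixInt n) j ^ 2) ∨
      ∀ i, (2 : ℤ) ^ m ∣ a i := by
  intro m
  induction m with
  | zero => simp
  | succ m ih =>
    intro hm
    rcases ih (by omega) with h | h
    · exact Or.inl h
    · refine (dH_le_or_two_pow_succ_dvd (I (m + 1)) a h (ha (m + 1) hm)).imp_left fun h' => ?_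
      exact ⟨m + 1, Finset.mem_Icc.2 ⟨by omega, hm⟩, by simpa using h'⟩

theorem four_pow_le_sum_sq {n r : ℕ} {a : Fin (2 ^ n) → ℤ} (ha : ∀ i, (2 : ℤ) ^ r ∣ a i)
    (h0 : a ᵥ* polarMatrixInt n ≠ 0) : (4 : ℤ) ^ r ≤ ∑ j, (a ᵥ* polarMatrixInt n) j ^ 2 := by
  choose μ hμ using ha
  obtain rfl : a = (2 : ℤ) ^ r • μ := funext fun i => by simp [hμ]
  rw [smul_vecMul] at h0 ⊢
  have h1 := one_le_sum_sq (right_ne_zero_of_smul h0)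
  have h3 : ∑ j, ((2 : ℤ) ^ r • (μ ᵥ* polarMatrixInt n)) j ^ 2 =
      4 ^ r * ∑ j, (μ ᵥ* polarMatrixInt n) j ^ 2 := by
    rw [Finset.mul_sum]
    refine Finset.sum_congr rfl fun j _ => ?_
    rw [Pi.smul_apply, smul_eq_mul, mul_pow, ← pow_mul, mul_comm r 2, pow_mul]
    norm_num
  rw [h3]
  exact le_mul_of_one_le_right (by positivity) h1

/-- For a polar lattice `Λ(Ḡ)` with rate profile
`∅ = I₀ ⊂ I₁ ⊆ ⋯ ⊆ I_r ⊆ I_{r+1} = {1,…,N}`, let `C_ℓ` (`1 ≤ ℓ ≤ r`) be the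
binary linear code generated over `𝔽₂` by the rows of `G_N` (mod 2) with
indices in `I_ℓ`.  Then the minimum squared Euclidean distance of the polar
lattice satisfies
`d²_min(Λ(Ḡ)) = min( min_{1 ≤ ℓ ≤ r} 4^{ℓ-1}·d_H(C_ℓ), 4^r )`. -/
theorem polar_lattice_dminSq_formula
    (n r : ℕ) (hn : 1 ≤ n) (hrN : r < 2 ^ n) (hr : 1 ≤ r)
    (I : ℕ → Finset (Fin (2 ^ n)))
    (hI0 : I 0 = ∅)
    (hItop : I (r + 1) = Finset.univ)
    (hchain : ∀ ℓ ≤ r, I ℓ ⊆ I (ℓ + 1))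
    (hstrict : I 0 ⊂ I 1)
    (lev : Fin (2 ^ n) → ℕ)
    (hlev : ∀ k, lev k ≤ r ∧ k ∈ I (lev k + 1) ∧ k ∉ I (lev k))
    (Gbar : Matrix (Fin (2 ^ n)) (Fin (2 ^ n)) ℝ)
    (hGbar : ∀ i j, Gbar i j = 2 ^ lev i * polarMatrix n i j) :
    dminSq (latticeOf Gbar) =
      min
        ((Finset.Icc 1 r).inf' (Finset.nonempty_Icc.mpr hr)
          fun ℓ => (4 : ℝ) ^ (ℓ - 1) * (dH (polarCode n (I ℓ)) : ℝ))
        ((4 : ℝ) ^ r) := by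
  have hmono : ∀ p q, p ≤ q → q ≤ r + 1 → I p ⊆ I q := by
    intro p q hpq
    induction q, hpq using Nat.le_induction with
    | base => exact fun _ => subset_rfl
    | succ q _ ih => exact fun hq => (ih (by omega)).trans (hchain q (by omega))
  have hrow : ∀ i m, lev i ≤ m → dminSq (latticeOf Gbar) ≤ (4 : ℝ) ^ m *
      (Finset.univ.filter fun j : Fin (2 ^ n) => j.val &&& i.val = j.val).card := by
    intro i m him
    have hx : ∀ j, ((fun k => (((Pi.single i (2 ^ (m - lev i)) : Fin (2 ^ n) → ℤ) k : ℤ) : ℝ))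
        ᵥ* Gbar) j = if j.val &&& i.val = j.val then 2 ^ m else 0 := by
      intro j
      have hcast : (fun k => (((Pi.single i (2 ^ (m - lev i)) : Fin (2 ^ n) → ℤ) k : ℤ) : ℝ)) =
          Pi.single i ((2 : ℝ) ^ (m - lev i)) := by
        funext k
        by_cases hk : k = i
        · subst hk
          simp
        · simp [hk]
      rw [hcast, single_vecMul]
      simp only [Pi.smul_apply, row_apply, smul_eq_mul, hGbar, polarMatrix]
      rw [← mul_assoc, ← pow_add, Nat.sub_add_cancel him]
      simp
    refine (dminSq_le (L := latticeOf Gbar) ⟨Pi.single i (2 ^ (m - lev i)), rfl⟩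
      fun h => ?_).trans_eq ?_
    · have := congrFun h i
      rw [hx] at this
      simp at this
    · simp only [hx]
      rw [Finset.card_filter]
      push_cast
      rw [Finset.mul_sum]
      refine Finset.sum_congr rfl fun j _ => ?_
      split_ifs
      · rw [← pow_mul, mul_comm m 2, pow_mul]
        norm_num
      · norm_num
  apply le_antisymm
  · refine le_min (Finset.le_inf' _ _ fun ℓ hℓ => ?_) ?_
    · rw [Finset.mem_Icc] at hℓ
      have hne : (I ℓ).Nonempty := by
        obtain ⟨k, hk, -⟩ := Finset.exists_of_ssubset hstrict
        exact ⟨k, hmono 1 ℓ hℓ.1 (by omega) hk⟩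
      obtain ⟨i, hi, hw⟩ := exists_row_weight_le_dH hne
      have hlevi : lev i ≤ ℓ - 1 := by
        by_contra hlt
        exact (hlev i).2.2 (hmono ℓ (lev i) (by omega) (by have := (hlev i).1; omega) hi)
      refine (hrow i (ℓ - 1) hlevi).trans ?_
      gcongr
    · refine (hrow ⟨0, by positivity⟩ r (hlev _).1).trans_eq ?_
      have : (Finset.univ.filter fun j : Fin (2 ^ n) =>
          j.val &&& (⟨0, by positivity⟩ : Fin (2 ^ n)).val = j.val) =
          {⟨0, by positivity⟩} := by
        ext j
        simp only [Finset.mem_filter, Finset.mem_univ, true_and, Nat.and_zero,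
          Finset.mem_singleton, Fin.ext_iff]
        exact eq_comm
      rw [this]
      simp
  · refine le_csInf ?_ ?_
    · refine ⟨_, _, ⟨Pi.single ⟨0, by positivity⟩ 1, rfl⟩, fun h => ?_, rfl⟩
      have h0 := congrFun h ⟨0, by positivity⟩
      have hcast : (fun k => (((Pi.single ⟨0, by positivity⟩ 1 : Fin (2 ^ n) → ℤ) k : ℤ) : ℝ)) =
          Pi.single ⟨0, by positivity⟩ 1 := by
        funext k
        simp [Pi.single_apply]
      rw [hcast, single_vecMul] at h0
      simp [hGbar, polarMatrix] at h0
    · rintro d ⟨x, ⟨lam, rfl⟩, hx0, rfl⟩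
      set a : Fin (2 ^ n) → ℤ := fun i => 2 ^ lev i * lam i with ha
      have hxa : ∀ j, ((fun i => (lam i : ℝ)) ᵥ* Gbar) j =
          ((a ᵥ* polarMatrixInt n) j : ℤ) := by
        intro j
        simp only [vecMul, dotProduct, hGbar, polarMatrix, polarMatrixInt, ha]
        push_cast
        exact Finset.sum_congr rfl fun i _ => by ring
      have ha0 : a ᵥ* polarMatrixInt n ≠ 0 := fun h => hx0 (funext fun j => by
        rw [hxa, h]
        simp)
      have hdvd : ∀ m ≤ r, ∀ i, i ∉ I m → (2 : ℤ) ^ m ∣ a i := by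
        intro m hm i hi
        refine Dvd.dvd.mul_right (pow_dvd_pow 2 ?_) _
        by_contra hlt
        exact hi (hmono (lev i + 1) m (by omega) (by omega) (hlev i).2.1)
      have hsum : ∑ j, ((fun i => (lam i : ℝ)) ᵥ* Gbar) j ^ 2 =
          ((∑ j, (a ᵥ* polarMatrixInt n) j ^ 2 : ℤ) : ℝ) := by
        push_cast
        simp only [hxa]
      rw [hsum]
      rcases exists_dH_le_or_two_pow_dvd I a hdvd r le_rfl with ⟨ℓ, hℓ, h⟩ | h
      · refine (min_le_left _ _).trans ((Finset.inf'_le _ hℓ).trans ?_)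
        exact_mod_cast h
      · refine (min_le_right _ _).trans ?_
        exact_mod_cast four_pow_le_sum_sq h ha0
end

section
/- For fixed σ > 0, the differential entropy of the vℤ-aliased Gaussian converges to that of the unwrapped Gaussian as the lattice spacing grows: lim_{v → ∞} h(vℤ, σ²) = (1/2)·log₂(2πeσ²). In particular, taking v = 2^r with 2^r = √N, one has 2·h(2^r ℤ, σ²) → log₂(2πeσ²) as N → ∞. -/
open Real Filter

/-- The `vℤ`-aliased (wrapped) Gaussian density with noise variance `σ²`:
`f_{v,σ}(x) = Σ_{k∈ℤ} (1/√(2πσ²))·exp(−(x+kv)²/(2σ²))`, a probability density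
on the fundamental interval `[0, v)`. -/
noncomputable def wrappedGaussianDensity (v σ x : ℝ) : ℝ :=
  ∑' k : ℤ, (1 / Real.sqrt (2 * π * σ ^ 2)) *
    Real.exp (-(x + (k : ℝ) * v) ^ 2 / (2 * σ ^ 2))

/-- The differential entropy (in bits) `h(vℤ, σ²)` of the `vℤ`-aliased
Gaussian noise. -/
noncomputable def wrappedEntropy (v σ : ℝ) : ℝ :=
  -∫ x in (0 : ℝ)..v,
    wrappedGaussianDensity v σ x * Real.logb 2 (wrappedGaussianDensity v σ x)

open ProbabilityTheory MeasureTheory Topology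

theorem gaussianPDFReal_zero_sq (σ x : ℝ) :
    gaussianPDFReal 0 (σ ^ 2).toNNReal x =
      1 / √(2 * π * σ ^ 2) * exp (-x ^ 2 / (2 * σ ^ 2)) := by
  simp [gaussianPDFReal, Real.coe_toNNReal _ (sq_nonneg σ)]

theorem wrappedGaussianDensity_eq_tsum_gaussianPDFReal (v σ x : ℝ) :
    wrappedGaussianDensity v σ x =
      ∑' k : ℤ, gaussianPDFReal 0 (σ ^ 2).toNNReal (x + k * v) := by
  simp only [wrappedGaussianDensity, gaussianPDFReal_zero_sq]

theorem wrappedGaussianDensity_periodic (v σ : ℝ) :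
    Function.Periodic (wrappedGaussianDensity v σ) v := by
  intro x
  simp only [wrappedGaussianDensity_eq_tsum_gaussianPDFReal]
  rw [← (Equiv.addRight (1 : ℤ)).tsum_eq
    (fun k : ℤ => gaussianPDFReal 0 (σ ^ 2).toNNReal (x + k * v))]
  refine tsum_congr fun k => ?_
  congr 1
  simp only [Equiv.coe_addRight]
  push_cast
  ring

theorem measurable_wrappedGaussianDensity (v σ : ℝ) :
    Measurable (wrappedGaussianDensity v σ) := by
  simp only [funext (wrappedGaussianDensity_eq_tsum_gaussianPDFReal v σ)]
  exact Measurable.tsum fun k =>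
    (measurable_gaussianPDFReal 0 _).comp (measurable_id.add_const _)

theorem summable_exp_neg_mul_abs_sub_one_div {s : ℝ} (hs : 0 < s) :
    Summable fun k : ℤ => exp (-(|(k : ℝ)| - 1) / s) := by
  have h : Summable fun n : ℕ => exp (-((n : ℝ) - 1) / s) := by
    have h₀ := (Real.summable_exp_nat_mul_iff.mpr
      (show -(1 / s) < 0 by simpa using hs)).mul_left (exp (1 / s))
    refine h₀.congr fun n => ?_
    rw [← exp_add]
    congr 1
    ring
  exact Summable.of_nat_of_neg (by simpa using h) (by simpa using h)

/-- A translate of the Gaussian density by a nonzero multiple `kv` is dominated on `[-v/2, v/2]`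
by the density itself, with a factor decaying exponentially in `k`. -/
theorem gaussianPDFReal_add_int_mul_le (σ : ℝ) {v x : ℝ} (hv : 1 ≤ v) (hx : |x| ≤ v / 2) (k : ℤ) :
    gaussianPDFReal 0 (σ ^ 2).toNNReal (x + k * v) ≤
      gaussianPDFReal 0 (σ ^ 2).toNNReal x * exp (-(|(k : ℝ)| - 1) / (2 * σ ^ 2)) := by
  rw [gaussianPDFReal_zero_sq, gaussianPDFReal_zero_sq, mul_assoc (1 / _), ← exp_add, ← add_div]
  gcongr
  have hcross : -(|(k : ℝ)| * v ^ 2) ≤ 2 * x * (k * v) := by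
    have h := neg_abs_le (x * k)
    rw [abs_mul] at h
    nlinarith [mul_le_mul_of_nonneg_right hx (abs_nonneg (k : ℝ)), abs_nonneg (k : ℝ)]
  have hk : |(k : ℝ)| - 1 ≤ |(k : ℝ)| * (|(k : ℝ)| - 1) * v ^ 2 := by
    rcases eq_or_ne k 0 with rfl | hk
    · simp
    · have h1 : (1 : ℝ) ≤ |(k : ℝ)| := by exact_mod_cast Int.one_le_abs hk
      have hv2 : 1 ≤ v ^ 2 := one_le_pow₀ hv
      nlinarith [mul_nonneg (sub_nonneg.2 h1) (sub_nonneg.2 h1),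
        mul_nonneg (mul_nonneg (abs_nonneg (k : ℝ)) (sub_nonneg.2 h1)) (sub_nonneg.2 hv2)]
  nlinarith [sq_abs (k : ℝ)]

theorem summable_gaussianPDFReal_add_int_mul {σ v x : ℝ} (hσ : 0 < σ) (hv : 1 ≤ v)
    (hx : |x| ≤ v / 2) :
    Summable fun k : ℤ => gaussianPDFReal 0 (σ ^ 2).toNNReal (x + k * v) :=
  ((summable_exp_neg_mul_abs_sub_one_div (by positivity : 0 < 2 * σ ^ 2)).mul_left _).of_nonneg_of_le
    (fun _ => gaussianPDFReal_nonneg _ _ _) (gaussianPDFReal_add_int_mul_le σ hv hx)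

theorem gaussianPDFReal_le_wrappedGaussianDensity {σ v x : ℝ} (hσ : 0 < σ) (hv : 1 ≤ v)
    (hx : |x| ≤ v / 2) :
    gaussianPDFReal 0 (σ ^ 2).toNNReal x ≤ wrappedGaussianDensity v σ x := by
  rw [wrappedGaussianDensity_eq_tsum_gaussianPDFReal]
  simpa using (summable_gaussianPDFReal_add_int_mul hσ hv hx).le_tsum 0
    fun _ _ => gaussianPDFReal_nonneg _ _ _

theorem wrappedGaussianDensity_le {σ v x : ℝ} (hσ : 0 < σ) (hv : 1 ≤ v) (hx : |x| ≤ v / 2) :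
    wrappedGaussianDensity v σ x ≤ gaussianPDFReal 0 (σ ^ 2).toNNReal x *
      ∑' k : ℤ, exp (-(|(k : ℝ)| - 1) / (2 * σ ^ 2)) := by
  have hsum := summable_exp_neg_mul_abs_sub_one_div (by positivity : 0 < 2 * σ ^ 2)
  rw [wrappedGaussianDensity_eq_tsum_gaussianPDFReal, ← tsum_mul_left]
  exact (summable_gaussianPDFReal_add_int_mul hσ hv hx).tsum_le_tsum
    (gaussianPDFReal_add_int_mul_le σ hv hx) (hsum.mul_left _)

theorem tendsto_gaussianPDFReal_cobounded {σ : ℝ} (hσ : 0 < σ) :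
    Tendsto (gaussianPDFReal 0 (σ ^ 2).toNNReal) (Bornology.cobounded ℝ) (𝓝 0) := by
  simp only [funext (gaussianPDFReal_zero_sq σ)]
  rw [← mul_zero (1 / √(2 * π * σ ^ 2))]
  refine Tendsto.const_mul _ (tendsto_exp_atBot.comp ?_)
  have h : Tendsto (fun x : ℝ => ‖x‖ ^ 2 / (2 * σ ^ 2)) (Bornology.cobounded ℝ) atTop :=
    ((tendsto_pow_atTop two_ne_zero).comp tendsto_norm_cobounded_atTop).atTop_div_const
      (by positivity)
  refine (tendsto_neg_atTop_atBot.comp h).congr fun x => ?_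
  simp [neg_div]

theorem tendsto_wrappedGaussianDensity_atTop {σ : ℝ} (hσ : 0 < σ) (x : ℝ) :
    Tendsto (fun v => wrappedGaussianDensity v σ x) atTop
      (𝓝 (gaussianPDFReal 0 (σ ^ 2).toNNReal x)) := by
  have hsum := summable_exp_neg_mul_abs_sub_one_div (by positivity : 0 < 2 * σ ^ 2)
  simp only [wrappedGaussianDensity_eq_tsum_gaussianPDFReal]
  rw [← tsum_ite_eq (0 : ℤ) (fun _ => gaussianPDFReal 0 (σ ^ 2).toNNReal x)]
  refine tendsto_tsum_of_dominated_convergence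
    (hsum.mul_left (gaussianPDFReal 0 (σ ^ 2).toNNReal x)) (fun k => ?_) ?_
  · split_ifs with hk
    · simp [hk]
    · refine (tendsto_gaussianPDFReal_cobounded hσ).comp ?_
      have hk' : (k : ℝ) ≠ 0 := by exact_mod_cast hk
      rw [← tendsto_norm_atTop_iff_cobounded]
      have h : Tendsto (fun v : ℝ => |(k : ℝ)| * v - |x|) atTop atTop :=
        tendsto_atTop_add_const_right _ _ (tendsto_id.const_mul_atTop (abs_pos.2 hk'))
      refine tendsto_atTop_mono' _ ?_ h
      filter_upwards [eventually_ge_atTop 0] with v hv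
      have h1 := abs_sub_abs_le_abs_sub (k * v) (-x)
      rw [abs_mul, abs_of_nonneg hv, abs_neg] at h1
      simpa [add_comm] using h1
  · filter_upwards [eventually_ge_atTop (max 1 (2 * |x|))] with v hv k
    rw [Real.norm_of_nonneg (gaussianPDFReal_nonneg _ _ _)]
    exact gaussianPDFReal_add_int_mul_le σ (le_of_max_le_left hv)
      (by linarith [le_of_max_le_right hv]) k

theorem log_gaussianPDFReal {σ : ℝ} (hσ : 0 < σ) (x : ℝ) :
    log (gaussianPDFReal 0 (σ ^ 2).toNNReal x) =
      -(log (2 * π * σ ^ 2) / 2) - x ^ 2 / (2 * σ ^ 2) := by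
  rw [gaussianPDFReal_zero_sq, log_mul (by positivity) (exp_pos _).ne', log_exp, one_div, log_inv,
    log_sqrt (by positivity)]
  ring

theorem integrable_gaussianPDFReal_mul_sq (v : NNReal) :
    Integrable fun x => gaussianPDFReal 0 v x * x ^ 2 := by
  rcases eq_or_ne v 0 with rfl | hv
  · simp
  have h := (memLp_id_gaussianReal (μ := 0) (v := v) 2).integrable_sq
  rw [gaussianReal_of_var_ne_zero _ hv,
    integrable_withDensity_iff_integrable_smul' (measurable_gaussianPDF 0 v)
      (.of_forall fun _ => gaussianPDF_lt_top)] at h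
  simpa [toReal_gaussianPDF] using h

theorem integral_gaussianPDFReal_mul_sq {v : NNReal} (hv : v ≠ 0) :
    ∫ x, gaussianPDFReal 0 v x * x ^ 2 = v := by
  have h := variance_fun_id_gaussianReal (μ := 0) (v := v)
  rw [variance_eq_integral (by fun_prop), integral_id_gaussianReal,
    integral_gaussianReal_eq_integral_smul hv] at h
  simpa using h

/-- The differential entropy, in bits, of a centred Gaussian of variance `σ ^ 2`. -/
theorem integral_gaussianPDFReal_mul_logb {σ : ℝ} (hσ : 0 < σ) :
    ∫ x, gaussianPDFReal 0 (σ ^ 2).toNNReal x * logb 2 (gaussianPDFReal 0 (σ ^ 2).toNNReal x) =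
      -(1 / 2 * logb 2 (2 * π * exp 1 * σ ^ 2)) := by
  have hv : (σ ^ 2).toNNReal ≠ 0 := by simp [hσ.ne']
  have heq : ∀ x, gaussianPDFReal 0 (σ ^ 2).toNNReal x *
      logb 2 (gaussianPDFReal 0 (σ ^ 2).toNNReal x) =
      (-(log (2 * π * σ ^ 2) / 2) / log 2) * gaussianPDFReal 0 (σ ^ 2).toNNReal x -
      (1 / (2 * σ ^ 2) / log 2) * (gaussianPDFReal 0 (σ ^ 2).toNNReal x * x ^ 2) := by
    intro x
    rw [logb, log_gaussianPDFReal hσ]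
    ring
  simp only [heq]
  rw [integral_sub ((integrable_gaussianPDFReal _ _).const_mul _)
    ((integrable_gaussianPDFReal_mul_sq _).const_mul _), integral_const_mul, integral_const_mul,
    integral_gaussianPDFReal_eq_one _ hv, integral_gaussianPDFReal_mul_sq hv,
    Real.coe_toNNReal _ (sq_nonneg σ), logb,
    show 2 * π * exp 1 * σ ^ 2 = 2 * π * σ ^ 2 * exp 1 by ring,
    log_mul (by positivity) (exp_pos _).ne', log_exp]
  field_simp
  ring

theorem abs_mul_logb_le {a b c : ℝ} (ha : 0 < a) (hab : a ≤ b) (hb : b ≤ a * c) :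
    |b * logb 2 b| ≤ a * c * ((|log a| + log c) / log 2) := by
  have hc : 1 ≤ c := by nlinarith
  have h1 : log a ≤ log b := log_le_log ha hab
  have h2 : log b ≤ log a + log c := by
    rw [← log_mul ha.ne' (by positivity)]
    exact log_le_log (ha.trans_le hab) hb
  have h3 : |log b| ≤ |log a| + log c :=
    abs_le.2 ⟨by linarith [neg_abs_le (log a), log_nonneg hc], by linarith [le_abs_self (log a)]⟩
  have hlog2 : 0 < log 2 := log_pos one_lt_two
  rw [abs_mul, abs_of_pos (ha.trans_le hab), logb, abs_div, abs_of_pos hlog2]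
  gcongr

theorem wrappedEntropy_eq_integral_symm (v σ : ℝ) :
    wrappedEntropy v σ = -∫ x in -(v / 2)..v / 2,
      wrappedGaussianDensity v σ x * logb 2 (wrappedGaussianDensity v σ x) := by
  have hper : Function.Periodic
      (fun x => wrappedGaussianDensity v σ x * logb 2 (wrappedGaussianDensity v σ x)) v :=
    (wrappedGaussianDensity_periodic v σ).comp fun y => y * logb 2 y
  have h := hper.intervalIntegral_add_eq 0 (-(v / 2))
  rw [zero_add, show -(v / 2) + v = v / 2 by ring] at h
  rw [wrappedEntropy, h]

theorem tendsto_wrappedEntropy_atTop {σ : ℝ} (hσ : 0 < σ) :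
    Tendsto (fun v => wrappedEntropy v σ) atTop
      (𝓝 (1 / 2 * logb 2 (2 * π * exp 1 * σ ^ 2))) := by
  have hv : (σ ^ 2).toNNReal ≠ 0 := by simp [hσ.ne']
  set C := ∑' k : ℤ, exp (-(|(k : ℝ)| - 1) / (2 * σ ^ 2))
  set g := gaussianPDFReal 0 (σ ^ 2).toNNReal
  have hg : Integrable g := integrable_gaussianPDFReal _ _
  have hgm : Measurable g := measurable_gaussianPDFReal _ _
  have hcont : Continuous fun y : ℝ => y * logb 2 y := by
    simpa [logb, mul_div_assoc] using continuous_mul_log.div_const (log 2)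
  have hbound : Integrable fun x => g x * C * ((|log (g x)| + log C) / log 2) := by
    have hlog : Integrable fun x => g x * |log (g x)| := by
      have h : Integrable fun x => g x * log (g x) := by
        have := (hg.const_mul (-(log (2 * π * σ ^ 2) / 2))).sub
          ((integrable_gaussianPDFReal_mul_sq (σ ^ 2).toNNReal).const_mul (1 / (2 * σ ^ 2)))
        refine this.congr (.of_forall fun x => ?_)
        simp only [g, Pi.sub_apply, log_gaussianPDFReal hσ]
        ring
      refine h.abs.congr (.of_forall fun x => ?_)
      simp only [abs_mul, abs_of_nonneg (gaussianPDFReal_nonneg 0 (σ ^ 2).toNNReal x), g]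
    refine ((hlog.const_mul (C / log 2)).add (hg.const_mul (C * log C / log 2))).congr
      (.of_forall fun x => ?_)
    simp only [Pi.add_apply]
    ring
  have key : Tendsto (fun v => ∫ x, (Set.Ioc (-(v / 2)) (v / 2)).indicator
      (fun x => wrappedGaussianDensity v σ x * logb 2 (wrappedGaussianDensity v σ x)) x) atTop
      (𝓝 (∫ x, g x * logb 2 (g x))) := by
    refine tendsto_integral_filter_of_dominated_convergence _ (.of_forall fun v => ?_) ?_ hbound
      (.of_forall fun x => ?_)
    · exact ((hcont.measurable.comp (measurable_wrappedGaussianDensity v σ)).indicator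
        measurableSet_Ioc).aestronglyMeasurable
    · filter_upwards [eventually_ge_atTop 1] with v hv1
      refine .of_forall fun x => ?_
      by_cases hx : |x| ≤ v / 2
      · refine (norm_indicator_le_norm_self _ _).trans ?_
        exact abs_mul_logb_le (gaussianPDFReal_pos _ _ _ hv)
          (gaussianPDFReal_le_wrappedGaussianDensity hσ hv1 hx) (wrappedGaussianDensity_le hσ hv1 hx)
      · have hx' : x ∉ Set.Ioc (-(v / 2)) (v / 2) := fun h => hx (abs_le.2 ⟨h.1.le, h.2⟩)
        have h0 : |(0 : ℝ)| ≤ v / 2 := by simpa using by linarith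
        have hC : 1 ≤ C := by
          have h := (gaussianPDFReal_le_wrappedGaussianDensity hσ hv1 h0).trans
            (wrappedGaussianDensity_le hσ hv1 h0)
          exact (le_mul_iff_one_le_right (gaussianPDFReal_pos _ _ _ hv)).1 h
        have hgx : 0 ≤ g x := gaussianPDFReal_nonneg _ _ _
        have hlogC := log_nonneg hC
        rw [Set.indicator_of_notMem hx', norm_zero]
        positivity
    · refine ((hcont.tendsto _).comp (tendsto_wrappedGaussianDensity_atTop hσ x)).congr' ?_
      filter_upwards [eventually_gt_atTop (2 * |x|)] with v hv
      have hx : |x| < v / 2 := by linarith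
      have hmem : x ∈ Set.Ioc (-(v / 2)) (v / 2) := ⟨(abs_lt.1 hx).1, (abs_lt.1 hx).2.le⟩
      rw [Set.indicator_of_mem hmem]
      rfl
  have hlim := key.neg
  rw [integral_gaussianPDFReal_mul_logb hσ, neg_neg] at hlim
  refine hlim.congr' ?_
  filter_upwards [eventually_ge_atTop 0] with v hv0
  rw [wrappedEntropy_eq_integral_symm, intervalIntegral.integral_of_le (by linarith),
    integral_indicator measurableSet_Ioc]

/-- For fixed `σ > 0`, the differential entropy of the `vℤ`-aliased Gaussian
converges to that of the unwrapped Gaussian as the lattice spacing grows: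
`lim_{v → ∞} h(vℤ, σ²) = (1/2)·log₂(2πeσ²)`.  In particular, taking `v = 2^r`
with `2^r = √N`, one has `2·h(2^r ℤ, σ²) → log₂(2πeσ²)` as `N → ∞` (i.e. as
`r → ∞`). -/
theorem wrappedEntropy_tendsto_gaussian_entropy (σ : ℝ) (hσ : 0 < σ) :
    Tendsto (fun v : ℝ => wrappedEntropy v σ) atTop
      (nhds ((1 / 2) * Real.logb 2 (2 * π * Real.exp 1 * σ ^ 2))) ∧
    Tendsto (fun r : ℕ => 2 * wrappedEntropy ((2 : ℝ) ^ r) σ) atTop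
      (nhds (Real.logb 2 (2 * π * Real.exp 1 * σ ^ 2))) := by
  refine ⟨tendsto_wrappedEntropy_atTop hσ, ?_⟩
  have h := ((tendsto_wrappedEntropy_atTop hσ).comp
    (tendsto_pow_atTop_atTop_of_one_lt one_lt_two)).const_mul 2
  rwa [← mul_assoc, mul_one_div_cancel two_ne_zero, one_mul] at h
end

section
/- Let N = 4, r = 2, with rate profile I₁ = {4}, I₂ = {2,3,4}, I₃ = {1,2,3,4}. The polar lattice generator matrix is Ḡ = [[4,0,0,0],[2,2,0,0],[2,0,2,0],[1,1,1,1]] and, for the convolution matrix T = [[1,0,1,1],[0,1,0,1],[0,0,1,0],[0,0,0,1]], the PAC lattice generator matrix is Ḡ_pac = D·T·G₄ = [[12,4,8,4],[4,4,2,2],[2,0,2,0],[1,1,1,1]]. Moreover Ḡ_pac = T̄·Ḡ with T̄ = [[1,0,2,4],[0,1,0,2],[0,0,1,0],[0,0,0,1]], an integer matrix with determinant 1, and consequently the two lattices coincide: {λ·Ḡ_pac : λ ∈ ℤ⁴} = {λ·Ḡ : λ ∈ ℤ⁴}. -/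
open Matrix

/-- `G₄ = [[1,0],[1,1]]^{⊗2}`, viewed over `ℝ`. -/
def G4 : Matrix (Fin 4) (Fin 4) ℝ :=
  !![1, 0, 0, 0; 1, 1, 0, 0; 1, 0, 1, 0; 1, 1, 1, 1]

/-- The diagonal scaling matrix `D = diag(4,2,2,1)` corresponding to the rate
profile `I₁ = {4}`, `I₂ = {2,3,4}`, `I₃ = {1,2,3,4}` (rows in `I_{ℓ+1} \ I_ℓ`
are scaled by `2^ℓ`). -/
def Dmat : Matrix (Fin 4) (Fin 4) ℝ :=
  Matrix.diagonal ![4, 2, 2, 1]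

/-- The convolution matrix `T` of the example. -/
def Tmat : Matrix (Fin 4) (Fin 4) ℝ :=
  !![1, 0, 1, 1; 0, 1, 0, 1; 0, 0, 1, 0; 0, 0, 0, 1]

theorem latticeOf_intCast_mul_subset {N : ℕ} (U : Matrix (Fin N) (Fin N) ℤ)
    (B : Matrix (Fin N) (Fin N) ℝ) :
    latticeOf (U.map (Int.castRingHom ℝ) * B) ⊆ latticeOf B := by
  rintro x ⟨lam, rfl⟩
  refine ⟨lam ᵥ* U, ?_⟩
  rw [← Matrix.vecMul_vecMul]
  congr 1
  ext i
  simp [Matrix.vecMul, dotProduct]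

/-- Left multiplication by a unimodular integer matrix does not change the lattice. -/
theorem latticeOf_intCast_mul_of_isUnit {N : ℕ} (U : Matrix (Fin N) (Fin N) ℤ)
    (hU : IsUnit U.det) (B : Matrix (Fin N) (Fin N) ℝ) :
    latticeOf (U.map (Int.castRingHom ℝ) * B) = latticeOf B := by
  refine (latticeOf_intCast_mul_subset U B).antisymm ?_
  have h := latticeOf_intCast_mul_subset U⁻¹ (U.map (Int.castRingHom ℝ) * B)
  rwa [← Matrix.mul_assoc, ← Matrix.map_mul, Matrix.nonsing_inv_mul U hU,
    Matrix.map_one _ (map_zero _) (map_one _), Matrix.one_mul] at h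

/-- Examples 2 and 4 of the paper.
Let `N = 4`, `r = 2`, with rate profile `I₁ = {4}`, `I₂ = {2,3,4}`,
`I₃ = {1,2,3,4}`.  The polar lattice generator matrix is
`Ḡ = [[4,0,0,0],[2,2,0,0],[2,0,2,0],[1,1,1,1]]` and, for the convolution
matrix `T = [[1,0,1,1],[0,1,0,1],[0,0,1,0],[0,0,0,1]]`, the PAC lattice
generator matrix is `Ḡ_pac = D·T·G₄ = [[12,4,8,4],[4,4,2,2],[2,0,2,0],
[1,1,1,1]]`.  Moreover `Ḡ_pac = T̄·Ḡ` with
`T̄ = [[1,0,2,4],[0,1,0,2],[0,0,1,0],[0,0,0,1]]`, an integer matrix with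
determinant `1`, and consequently the two lattices coincide. -/
theorem pac_polar_example_equivalent :
    Dmat * G4 = !![4, 0, 0, 0; 2, 2, 0, 0; 2, 0, 2, 0; 1, 1, 1, 1] ∧
    Dmat * Tmat * G4 = !![12, 4, 8, 4; 4, 4, 2, 2; 2, 0, 2, 0; 1, 1, 1, 1] ∧
    Dmat * Tmat * G4 =
      (!![1, 0, 2, 4; 0, 1, 0, 2; 0, 0, 1, 0; 0, 0, 0, 1] :
        Matrix (Fin 4) (Fin 4) ℝ) * (Dmat * G4) ∧
    (!![1, 0, 2, 4; 0, 1, 0, 2; 0, 0, 1, 0; 0, 0, 0, 1] :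
        Matrix (Fin 4) (Fin 4) ℝ).det = 1 ∧
    latticeOf (Dmat * Tmat * G4) = latticeOf (Dmat * G4) := by
  have hpolar : Dmat * G4 = !![4, 0, 0, 0; 2, 2, 0, 0; 2, 0, 2, 0; 1, 1, 1, 1] := by
    ext i j
    fin_cases i <;> fin_cases j <;> norm_num [Dmat, G4]
  have hpac : Dmat * Tmat * G4 =
      !![12, 4, 8, 4; 4, 4, 2, 2; 2, 0, 2, 0; 1, 1, 1, 1] := by
    rw [Matrix.mul_assoc]
    ext i j
    fin_cases i <;> fin_cases j <;> norm_num [Dmat, Tmat, G4]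
  have hmul : Dmat * Tmat * G4 =
      (!![1, 0, 2, 4; 0, 1, 0, 2; 0, 0, 1, 0; 0, 0, 0, 1] :
        Matrix (Fin 4) (Fin 4) ℝ) * (Dmat * G4) := by
    rw [hpac, hpolar]
    ext i j
    fin_cases i <;> fin_cases j <;> norm_num
  have hmap : (!![1, 0, 2, 4; 0, 1, 0, 2; 0, 0, 1, 0; 0, 0, 0, 1] :
        Matrix (Fin 4) (Fin 4) ℝ) =
      (!![1, 0, 2, 4; 0, 1, 0, 2; 0, 0, 1, 0; 0, 0, 0, 1] :
        Matrix (Fin 4) (Fin 4) ℤ).map (Int.castRingHom ℝ) := by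
    ext i j
    fin_cases i <;> fin_cases j <;> simp
  have hdet : (!![1, 0, 2, 4; 0, 1, 0, 2; 0, 0, 1, 0; 0, 0, 0, 1] :
      Matrix (Fin 4) (Fin 4) ℤ).det = 1 := by decide
  refine ⟨hpolar, hpac, hmul, ?_, ?_⟩
  · rw [hmap, ← RingHom.mapMatrix_apply, ← RingHom.map_det, hdet, map_one]
  · rw [hmul, hmap]
    exact latticeOf_intCast_mul_of_isUnit _ (hdet ▸ isUnit_one) _
end
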